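/- arXiv:0810.5045 — 2 statements merged into one kernel-verified Lean document; each statement's English description precedes it below -/
import Mathlib

section
/- There exists a function s : [0,1) → (0,∞) such that the map Φ is a bijection from S = {(w,ū) ∈ ℝ×ℝ³ : 0 ≤ w, γK w² < 1} onto Ω = {(y,v) ∈ ℝ×ℝ³ : |v|²_h < 1 and 0 ≤ y < s(|v|_h)}; moreover Φ and its inverse are continuous, and Φ restricts to a C^∞ diffeomorphism between the interiors {(w,ū) : 0 < w, γK w² < 1} and {(y,v) ∈ Ω : y > 0}. -/
open Real Set

noncomputable section

/-- The squared `h`-norm `|v|²_h = h_{ab} v^a v^b`. -/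
def hQuad (h : Matrix (Fin 3) (Fin 3) ℝ) (v : Fin 3 → ℝ) : ℝ :=
  ∑ a, ∑ b, h a b * v a * v b

/-- The map `Φ(w,ū) = ( w[1+(1+Kw²)|ū|²_h]^{(γ−1)/2} ,
(1+Kw²) ū √(1+|ū|²_h) / (1+(1+Kw²)|ū|²_h) )` from the Makino variable and the projected
velocity to the rescaled matter variables. -/
def PhiMap (K γ : ℝ) (h : Matrix (Fin 3) (Fin 3) ℝ) (p : ℝ × (Fin 3 → ℝ)) :
    ℝ × (Fin 3 → ℝ) :=
  ( p.1 * (1 + (1 + K * p.1 ^ 2) * hQuad h p.2) ^ ((γ - 1) / 2),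
    fun a => (1 + K * p.1 ^ 2) * p.2 a * Real.sqrt (1 + hQuad h p.2) /
      (1 + (1 + K * p.1 ^ 2) * hQuad h p.2) )

theorem hQuad_smul (h : Matrix (Fin 3) (Fin 3) ℝ) (c : ℝ) (v : Fin 3 → ℝ) :
    hQuad h (fun a => c * v a) = c ^ 2 * hQuad h v := by
  simp only [hQuad, Finset.mul_sum]
  exact Finset.sum_congr rfl fun a _ => Finset.sum_congr rfl fun b _ => by ring

theorem hQuad_nonneg {h : Matrix (Fin 3) (Fin 3) ℝ} (hpos : h.PosDef) (v : Fin 3 → ℝ) :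
    0 ≤ hQuad h v := by
  have hv := hpos.posSemidef.dotProduct_mulVec_nonneg v
  have e : hQuad h v = star v ⬝ᵥ h.mulVec v := by
    simp only [hQuad, dotProduct, Matrix.mulVec, Finset.mul_sum]
    exact Finset.sum_congr rfl fun a _ => Finset.sum_congr rfl fun b _ => by simp; ring
  rwa [e]

theorem contDiff_hQuad (h : Matrix (Fin 3) (Fin 3) ℝ) {n : WithTop ℕ∞} :
    ContDiff ℝ n (hQuad h) := by
  unfold hQuad
  fun_prop

/-- The positive root `D` of `(1 - ρ) D² = (1 - K w²) D + K w²`. -/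
def densRoot (K w ρ : ℝ) : ℝ :=
  ((1 - K * w ^ 2) + √((1 - K * w ^ 2) ^ 2 + 4 * (1 - ρ) * (K * w ^ 2))) / (2 * (1 - ρ))

section DensRoot

variable {K w ρ : ℝ}

theorem densRoot_pos (hw : K * w ^ 2 < 1) (hρ : ρ < 1) : 0 < densRoot K w ρ := by
  unfold densRoot
  have := Real.sqrt_nonneg ((1 - K * w ^ 2) ^ 2 + 4 * (1 - ρ) * (K * w ^ 2))
  exact div_pos (by linarith) (by linarith)

theorem densRoot_radicand_pos (hK : 0 ≤ K) (hw : K * w ^ 2 < 1) (hρ : ρ < 1) :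
    0 < (1 - K * w ^ 2) ^ 2 + 4 * (1 - ρ) * (K * w ^ 2) := by
  have h1 : 0 < 1 - K * w ^ 2 := by linarith
  have h2 : 0 < 1 - ρ := by linarith
  positivity

theorem densRoot_eq (hK : 0 ≤ K) (hw : K * w ^ 2 < 1) (hρ : ρ < 1) :
    (1 - ρ) * densRoot K w ρ ^ 2 = (1 - K * w ^ 2) * densRoot K w ρ + K * w ^ 2 := by
  have h2 : 1 - ρ ≠ 0 := by linarith
  have hs := Real.sq_sqrt (densRoot_radicand_pos hK hw hρ).le
  unfold densRoot
  set R := √((1 - K * w ^ 2) ^ 2 + 4 * (1 - ρ) * (K * w ^ 2))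
  field_simp
  linear_combination hs

theorem eq_densRoot (hK : 0 ≤ K) (hw : K * w ^ 2 < 1) (hρ : ρ < 1) {D : ℝ} (hD : 0 < D)
    (h : (1 - ρ) * D ^ 2 = (1 - K * w ^ 2) * D + K * w ^ 2) : D = densRoot K w ρ := by
  have hE := densRoot_pos hw hρ
  have he := densRoot_eq hK hw hρ
  set E := densRoot K w ρ
  have hb : 0 ≤ K * w ^ 2 := by positivity
  have h1 : (1 - K * w ^ 2) ≤ (1 - ρ) * D := by
    by_contra! hc
    nlinarith
  have h2 : 0 < (1 - ρ) * (D + E) - (1 - K * w ^ 2) := by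
    have : 0 < (1 - ρ) * E := mul_pos (by linarith) hE
    linarith
  have h3 : (D - E) * ((1 - ρ) * (D + E) - (1 - K * w ^ 2)) = 0 := by
    linear_combination h - he
  rcases mul_eq_zero.1 h3 with h4 | h4 <;> linarith

theorem one_le_densRoot (hK : 0 ≤ K) (hw : K * w ^ 2 < 1) (hρ0 : 0 ≤ ρ) (hρ : ρ < 1) :
    1 ≤ densRoot K w ρ := by
  have hE := densRoot_pos hw hρ
  have he := densRoot_eq hK hw hρ
  set E := densRoot K w ρ
  have hb : 0 ≤ K * w ^ 2 := by positivity
  by_contra! hc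
  have : 0 < (1 - E) * (E + K * w ^ 2) := mul_pos (by linarith) (by linarith)
  nlinarith [mul_nonneg hρ0 (sq_nonneg E)]

theorem contDiffAt_densRoot (hK : 0 ≤ K) (hw : K * w ^ 2 < 1) (hρ : ρ < 1) {n : WithTop ℕ∞} :
    ContDiffAt ℝ n (fun p : ℝ × ℝ => densRoot K p.1 p.2) (w, ρ) := by
  have h1 := (densRoot_radicand_pos hK hw hρ).ne'
  have h2 : 2 * (1 - ρ) ≠ 0 := by linarith
  unfold densRoot
  exact ContDiffAt.div (by fun_prop (disch := assumption)) (by fun_prop) h2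

theorem exists_hasDerivAt_densRoot (hK : 0 ≤ K) (hw : K * w ^ 2 < 1) (hρ : ρ < 1) :
    ∃ d : ℝ, HasDerivAt (fun x => densRoot K x ρ) d w ∧
      d * (2 * (1 - ρ) * densRoot K w ρ - (1 - K * w ^ 2)) =
        2 * K * w * (1 - densRoot K w ρ) := by
  have hd : DifferentiableAt ℝ (fun x => densRoot K x ρ) w := by
    have h1 : DifferentiableAt ℝ (fun p : ℝ × ℝ => densRoot K p.1 p.2) (w, ρ) :=
      (contDiffAt_densRoot hK hw hρ (n := 1)).differentiableAt (by simp)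
    exact h1.comp (f := fun x : ℝ => (x, ρ)) w (by fun_prop)
  refine ⟨_, hd.hasDerivAt, ?_⟩
  have hev : (fun x => (1 - ρ) * densRoot K x ρ ^ 2) =ᶠ[nhds w]
      fun x => (1 - K * x ^ 2) * densRoot K x ρ + K * x ^ 2 := by
    have : ∀ᶠ x in nhds w, K * x ^ 2 < 1 :=
      (by fun_prop : Continuous fun x : ℝ => K * x ^ 2).continuousAt.eventually_lt_const hw
    filter_upwards [this] with x hx using densRoot_eq hK hx hρ
  have hsq : HasDerivAt (fun x : ℝ => K * x ^ 2) (K * (2 * w)) w := by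
    simpa using (hasDerivAt_pow 2 w).const_mul K
  have hl := (hd.hasDerivAt.pow 2).const_mul (1 - ρ)
  have hr := ((hsq.const_sub 1).mul hd.hasDerivAt).add hsq
  have := (hl.congr_of_eventuallyEq hev.symm).unique hr
  simp at this
  linear_combination this

/-- At fixed `ρ`, the rescaled density `w D^((γ - 1) / 2)` has positive derivative in `w`. -/
theorem exists_hasDerivAt_mul_densRoot_rpow (hK : 0 ≤ K) {γ : ℝ} (hγ : 1 ≤ γ)
    (hw : γ * K * w ^ 2 < 1) (hρ0 : 0 ≤ ρ) (hρ : ρ < 1) :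
    ∃ d : ℝ, 0 < d ∧ HasDerivAt (fun x => x * densRoot K x ρ ^ ((γ - 1) / 2)) d w := by
  obtain ⟨c, hc, rfl⟩ : ∃ c : ℝ, 0 ≤ c ∧ γ = 2 * c + 1 := ⟨(γ - 1) / 2, by linarith, by ring⟩
  rw [show (2 * c + 1 - 1) / 2 = c by ring]
  have hb : 0 ≤ K * w ^ 2 := by positivity
  have hw1 : K * w ^ 2 < 1 := by nlinarith
  obtain ⟨d, hd, hdd⟩ := exists_hasDerivAt_densRoot hK hw1 hρ
  have hD := densRoot_pos hw1 hρ
  have hD1 := one_le_densRoot hK hw1 hρ0 hρ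
  have he := densRoot_eq hK hw1 hρ
  have hg := (hasDerivAt_id w).mul (hd.rpow_const (p := c) (Or.inl hD.ne'))
  refine ⟨_, ?_, hg⟩
  set D := densRoot K w ρ
  simp only [id]
  have hp : D ^ c = D ^ (c - 1) * D := by
    rw [← Real.rpow_add_one hD.ne']; simp
  rw [hp]
  have hpp : 0 < D ^ (c - 1) := Real.rpow_pos_of_pos hD _
  set R := 2 * (1 - ρ) * D - (1 - K * w ^ 2) with hR
  have hDR : D * R = (1 - K * w ^ 2) * D + 2 * (K * w ^ 2) := by
    rw [hR]; linear_combination 2 * he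
  have hRpos : 0 < R := by
    have : 0 < D * R := by rw [hDR]; nlinarith [mul_pos (sub_pos.2 hw1) hD]
    exact (pos_iff_pos_of_mul_pos this).1 hD
  have key : 0 < D + c * w * d := by
    have : 0 < (D + c * w * d) * R := by
      have e : (D + c * w * d) * R = D * R - 2 * c * (K * w ^ 2) * (D - 1) := by
        linear_combination c * w * hdd
      rw [e, hDR]
      nlinarith
    exact (pos_iff_pos_of_mul_pos this).2 hRpos
  have := mul_pos hpp key
  nlinarith

end DensRoot

/-- A left inverse of a `C^n` map with injective derivatives on an open set is `C^n` on the
image. -/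
theorem contDiffAt_of_leftInvOn {E : Type*} [NormedAddCommGroup E] [NormedSpace ℝ E]
    [FiniteDimensional ℝ E] {f g : E → E} {U : Set E} (hU : IsOpen U) {n : WithTop ℕ∞}
    (hn : n ≠ 0) (hg : LeftInvOn g f U) {x : E} (hx : x ∈ U) (hf : ContDiffAt ℝ n f x)
    (hinj : Function.Injective (fderiv ℝ f x)) : ContDiffAt ℝ n g (f x) := by
  have : CompleteSpace E := FiniteDimensional.complete ℝ E
  let e : E ≃L[ℝ] E :=
    (LinearEquiv.ofInjectiveEndo (fderiv ℝ f x : E →ₗ[ℝ] E) hinj).toContinuousLinearEquiv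
  have he : (e : E →L[ℝ] E) = fderiv ℝ f x := by ext; rfl
  have hd : HasFDerivAt f (e : E →L[ℝ] E) x := he ▸ (hf.differentiableAt hn).hasFDerivAt
  refine (hf.to_localInverse hd hn).congr_of_eventuallyEq ?_
  exact (hf.hasStrictFDerivAt' hd hn).localInverse_unique
    (Filter.eventually_of_mem (hU.mem_nhds hx) hg)

/-- The map `(w, v) ↦ (w D^((γ - 1) / 2), v)`, expressing the rescaled density through the
Makino variable and the rescaled velocity. -/
def densMap (K γ : ℝ) (h : Matrix (Fin 3) (Fin 3) ℝ) (p : ℝ × (Fin 3 → ℝ)) :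
    ℝ × (Fin 3 → ℝ) :=
  (p.1 * densRoot K p.1 (hQuad h p.2) ^ ((γ - 1) / 2), p.2)

/-- The map `(w, ū) ↦ (w, v)`. -/
def velMap (K γ : ℝ) (h : Matrix (Fin 3) (Fin 3) ℝ) (p : ℝ × (Fin 3 → ℝ)) :
    ℝ × (Fin 3 → ℝ) :=
  (p.1, (PhiMap K γ h p).2)

/-- The inverse `(w, v) ↦ (w, ū)` of `velMap`. -/
def velInv (K : ℝ) (h : Matrix (Fin 3) (Fin 3) ℝ) (p : ℝ × (Fin 3 → ℝ)) : ℝ × (Fin 3 → ℝ) :=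
  (p.1, fun a => densRoot K p.1 (hQuad h p.2) / ((1 + K * p.1 ^ 2) *
    √(1 + (densRoot K p.1 (hQuad h p.2) - 1) / (1 + K * p.1 ^ 2))) * p.2 a)

/-- The set of all `(w, v)` satisfying the causality conditions, without the sign condition. -/
def causalSet (K γ : ℝ) (h : Matrix (Fin 3) (Fin 3) ℝ) : Set (ℝ × (Fin 3 → ℝ)) :=
  {p | γ * K * p.1 ^ 2 < 1 ∧ hQuad h p.2 < 1}

/-- The upper bound for the rescaled density at velocity norm `r`. -/
def densBound (K γ r : ℝ) : ℝ :=
  (√(γ * K))⁻¹ * densRoot K (√(γ * K))⁻¹ (r ^ 2) ^ ((γ - 1) / 2)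

section

variable {K γ : ℝ} {h : Matrix (Fin 3) (Fin 3) ℝ}

theorem mul_sq_lt_one_of_causal (hK : 0 < K) (hγ : 1 < γ) {w : ℝ} (hw : γ * K * w ^ 2 < 1) :
    K * w ^ 2 < 1 := by
  have : 0 ≤ K * w ^ 2 := by positivity
  nlinarith

theorem causal_iff_mem_Ioo (hK : 0 < K) (hγ : 1 < γ) {w : ℝ} :
    γ * K * w ^ 2 < 1 ↔ w ∈ Ioo (-(√(γ * K))⁻¹) (√(γ * K))⁻¹ := by
  have h0 : 0 < γ * K := by positivity
  rw [mem_Ioo, ← abs_lt, ← Real.sqrt_inv, Real.lt_sqrt (abs_nonneg w), sq_abs,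
    ← lt_inv_mul_iff₀ h0, mul_one]

theorem mul_inv_sqrt_sq_lt_one (hK : 0 < K) (hγ : 1 < γ) : K * (√(γ * K))⁻¹ ^ 2 < 1 := by
  rw [inv_pow, Real.sq_sqrt (by positivity), mul_inv_lt_iff₀ (by positivity)]
  nlinarith

theorem densBound_pos (hK : 0 < K) (hγ : 1 < γ) {r : ℝ} (hr : r ∈ Ico (0 : ℝ) 1) :
    0 < densBound K γ r := by
  have hr2 : r ^ 2 < 1 := by nlinarith [hr.1, hr.2]
  have h1 := densRoot_pos (mul_inv_sqrt_sq_lt_one hK hγ) hr2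
  unfold densBound
  positivity

theorem continuousOn_mul_densRoot_rpow (hK : 0 < K) (hγ : 1 < γ) {ρ : ℝ} (hρ : ρ < 1) :
    ContinuousOn (fun x => x * densRoot K x ρ ^ ((γ - 1) / 2))
      (Icc (-(√(γ * K))⁻¹) (√(γ * K))⁻¹) := by
  intro w hw
  have hw1 : K * w ^ 2 < 1 := by
    refine lt_of_le_of_lt ?_ (mul_inv_sqrt_sq_lt_one hK hγ)
    gcongr 1
    exact sq_le_sq' hw.1 hw.2
  obtain ⟨d, hd, -⟩ := exists_hasDerivAt_densRoot hK.le hw1 hρ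
  exact (continuousAt_id.mul (hd.continuousAt.rpow_const
    (Or.inl (densRoot_pos hw1 hρ).ne'))).continuousWithinAt

theorem strictMonoOn_mul_densRoot_rpow (hK : 0 < K) (hγ : 1 < γ) {ρ : ℝ} (hρ0 : 0 ≤ ρ)
    (hρ : ρ < 1) :
    StrictMonoOn (fun x => x * densRoot K x ρ ^ ((γ - 1) / 2))
      (Icc (-(√(γ * K))⁻¹) (√(γ * K))⁻¹) := by
  refine strictMonoOn_of_deriv_pos (convex_Icc _ _) (continuousOn_mul_densRoot_rpow hK hγ hρ) ?_
  intro w hw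
  rw [interior_Icc] at hw
  obtain ⟨d, hd, hdd⟩ := exists_hasDerivAt_mul_densRoot_rpow hK.le hγ.le
    ((causal_iff_mem_Ioo hK hγ).2 hw) hρ0 hρ
  rwa [hdd.deriv]

theorem bijOn_mul_densRoot_rpow (hK : 0 < K) (hγ : 1 < γ) {ρ : ℝ} (hρ0 : 0 ≤ ρ) (hρ : ρ < 1) :
    BijOn (fun x => x * densRoot K x ρ ^ ((γ - 1) / 2))
      {w | γ * K * w ^ 2 < 1} {y | |y| < densBound K γ √ρ} := by
  have hm := strictMonoOn_mul_densRoot_rpow hK hγ hρ0 hρ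
  have hc := continuousOn_mul_densRoot_rpow (γ := γ) hK hγ hρ
  have hs : {w | γ * K * w ^ 2 < 1} = Ioo (-(√(γ * K))⁻¹) (√(γ * K))⁻¹ := by
    ext w; exact causal_iff_mem_Ioo hK hγ
  have ht : {y | |y| < densBound K γ √ρ} = Ioo (-densBound K γ √ρ) (densBound K γ √ρ) := by
    ext y; exact abs_lt (a := y)
  have hle : -(√(γ * K))⁻¹ ≤ (√(γ * K))⁻¹ := neg_le_self (by positivity)
  have hr : (fun x => x * densRoot K x ρ ^ ((γ - 1) / 2)) (√(γ * K))⁻¹ = densBound K γ √ρ := by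
    simp only [densBound, Real.sq_sqrt hρ0]
  have hl : (fun x => x * densRoot K x ρ ^ ((γ - 1) / 2)) (-(√(γ * K))⁻¹) =
      -densBound K γ √ρ := by
    simp only [densBound, Real.sq_sqrt hρ0, densRoot, neg_sq, neg_mul]
  rw [hs, ht, ← hl, ← hr]
  refine ⟨fun w hw => ?_, hm.injOn.mono Ioo_subset_Icc_self, intermediate_value_Ioo hle hc⟩
  exact ⟨hm (left_mem_Icc.2 hle) (Ioo_subset_Icc_self hw) hw.1,
    hm (Ioo_subset_Icc_self hw) (right_mem_Icc.2 hle) hw.2⟩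

theorem bijOn_densMap (hK : 0 < K) (hγ : 1 < γ) (hpos : h.PosDef) :
    BijOn (densMap K γ h) (causalSet K γ h)
      {q | hQuad h q.2 < 1 ∧ |q.1| < densBound K γ √(hQuad h q.2)} := by
  refine ⟨fun p hp => ⟨hp.2, ?_⟩, ?_, ?_⟩
  · exact (bijOn_mul_densRoot_rpow hK hγ (hQuad_nonneg hpos p.2) hp.2).mapsTo hp.1
  · rintro ⟨w, v⟩ hp ⟨w', v'⟩ hp' heq
    obtain rfl : v = v' := congrArg Prod.snd heq
    have : w = w' := (bijOn_mul_densRoot_rpow hK hγ (hQuad_nonneg hpos v) hp.2).injOn hp.1 hp'.1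
      (congrArg Prod.fst heq)
    rw [this]
  · rintro ⟨y, v⟩ ⟨hv, hy⟩
    obtain ⟨w, hw, rfl⟩ := (bijOn_mul_densRoot_rpow hK hγ (hQuad_nonneg hpos v) hv).surjOn hy
    exact ⟨(w, v), ⟨hw, hv⟩, rfl⟩

theorem isOpen_causalSet : IsOpen (causalSet K γ h) :=
  (isOpen_lt (by fun_prop : Continuous fun p : ℝ × (Fin 3 → ℝ) => γ * K * p.1 ^ 2)
    continuous_const).inter (isOpen_lt ((contDiff_hQuad h (n := 0)).continuous.comp continuous_snd) continuous_const)

theorem contDiffAt_densRoot_hQuad (hK : 0 < K) (hγ : 1 < γ) {p : ℝ × (Fin 3 → ℝ)}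
    (hp : p ∈ causalSet K γ h) {n : WithTop ℕ∞} :
    ContDiffAt ℝ n (fun p : ℝ × (Fin 3 → ℝ) => densRoot K p.1 (hQuad h p.2)) p := by
  have h1 := contDiffAt_densRoot hK.le (mul_sq_lt_one_of_causal hK hγ hp.1) hp.2 (n := n)
  have h2 : ContDiff ℝ n (fun p : ℝ × (Fin 3 → ℝ) => (p.1, hQuad h p.2)) :=
    contDiff_fst.prodMk ((contDiff_hQuad h).comp contDiff_snd)
  exact h1.comp p h2.contDiffAt

theorem contDiffAt_densMap (hK : 0 < K) (hγ : 1 < γ) {p : ℝ × (Fin 3 → ℝ)}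
    (hp : p ∈ causalSet K γ h) {n : WithTop ℕ∞} : ContDiffAt ℝ n (densMap K γ h) p := by
  refine ContDiffAt.prodMk (contDiffAt_fst.mul ?_) contDiffAt_snd
  exact (contDiffAt_densRoot_hQuad hK hγ hp).rpow_const_of_ne
    (densRoot_pos (mul_sq_lt_one_of_causal hK hγ hp.1) hp.2).ne'

theorem injective_fderiv_densMap (hK : 0 < K) (hγ : 1 < γ) (hpos : h.PosDef)
    {p : ℝ × (Fin 3 → ℝ)} (hp : p ∈ causalSet K γ h) :
    Function.Injective (fderiv ℝ (densMap K γ h) p) := by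
  have hd := ((contDiffAt_densMap hK hγ hp (n := 1)).differentiableAt (by simp)).hasFDerivAt
  obtain ⟨d, hd0, hdd⟩ := exists_hasDerivAt_mul_densRoot_rpow hK.le hγ.le hp.1
    (hQuad_nonneg hpos p.2) hp.2
  have hsnd : ∀ z, (fderiv ℝ (densMap K γ h) p z).2 = z.2 := fun z =>
    congrArg (fun L : ℝ × (Fin 3 → ℝ) →L[ℝ] (Fin 3 → ℝ) => L z) (hd.snd.unique hasFDerivAt_snd)
  have hfst : (fderiv ℝ (densMap K γ h) p (1, 0)).1 = d := by
    have hl : HasDerivAt (fun x : ℝ => (x, p.2)) (1, 0) p.1 :=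
      (hasDerivAt_id p.1).prodMk (hasDerivAt_const _ _)
    exact (hd.fst.comp_hasDerivAt_of_eq p.1 hl rfl).unique hdd
  rw [injective_iff_map_eq_zero]
  rintro ⟨x, v⟩ hz
  have hv : v = 0 := (hsnd (x, v)).symm.trans (congrArg Prod.snd hz)
  subst hv
  have e : ((x, 0) : ℝ × (Fin 3 → ℝ)) = x • ((1, 0) : ℝ × (Fin 3 → ℝ)) := by simp
  rw [e, map_smul] at hz
  have hx : x * d = 0 := by rw [← hfst]; exact congrArg Prod.fst hz
  rw [(mul_eq_zero.1 hx).resolve_right hd0.ne']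
  rfl

theorem velMap_mem_and_densRoot (hK : 0 < K) (hγ : 1 < γ) (hpos : h.PosDef)
    {p : ℝ × (Fin 3 → ℝ)} (hp : γ * K * p.1 ^ 2 < 1) :
    velMap K γ h p ∈ causalSet K γ h ∧
      densRoot K p.1 (hQuad h (velMap K γ h p).2) = 1 + (1 + K * p.1 ^ 2) * hQuad h p.2 := by
  have hw := mul_sq_lt_one_of_causal hK hγ hp
  have hb : 0 ≤ K * p.1 ^ 2 := by positivity
  have hq := hQuad_nonneg hpos p.2
  have hD : 0 < 1 + (1 + K * p.1 ^ 2) * hQuad h p.2 := by positivity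
  have hv : (velMap K γ h p).2 = fun a => (1 + K * p.1 ^ 2) * √(1 + hQuad h p.2) /
      (1 + (1 + K * p.1 ^ 2) * hQuad h p.2) * p.2 a := by
    funext a
    simp only [velMap, PhiMap]
    ring
  have hρ : hQuad h (velMap K γ h p).2 = (1 + K * p.1 ^ 2) ^ 2 * (1 + hQuad h p.2) /
      (1 + (1 + K * p.1 ^ 2) * hQuad h p.2) ^ 2 * hQuad h p.2 := by
    rw [hv, hQuad_smul, div_pow, mul_pow, Real.sq_sqrt (by positivity)]
  have hlt : hQuad h (velMap K γ h p).2 < 1 := by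
    rw [hρ, div_mul_eq_mul_div, div_lt_one (by positivity)]
    have : 0 ≤ (1 + K * p.1 ^ 2) * (1 - K * p.1 ^ 2) * hQuad h p.2 :=
      mul_nonneg (mul_nonneg (by positivity) (by linarith)) hq
    nlinarith
  refine ⟨⟨hp, hlt⟩, (eq_densRoot hK.le hw hlt hD ?_).symm⟩
  rw [hρ]
  field_simp
  ring

theorem densMap_velMap (hK : 0 < K) (hγ : 1 < γ) (hpos : h.PosDef)
    {p : ℝ × (Fin 3 → ℝ)} (hp : γ * K * p.1 ^ 2 < 1) :
    densMap K γ h (velMap K γ h p) = PhiMap K γ h p := by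
  have := (velMap_mem_and_densRoot hK hγ hpos hp).2
  refine Prod.ext ?_ rfl
  change p.1 * densRoot K p.1 (hQuad h (velMap K γ h p).2) ^ ((γ - 1) / 2) = _
  rw [this]
  rfl

theorem velInv_velMap (hK : 0 < K) (hγ : 1 < γ) (hpos : h.PosDef)
    {p : ℝ × (Fin 3 → ℝ)} (hp : γ * K * p.1 ^ 2 < 1) :
    velInv K h (velMap K γ h p) = p := by
  have hb : 0 ≤ K * p.1 ^ 2 := by positivity
  have hq := hQuad_nonneg hpos p.2
  have hD : 0 < 1 + (1 + K * p.1 ^ 2) * hQuad h p.2 := by positivity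
  refine Prod.ext rfl (funext fun a => ?_)
  change densRoot K p.1 (hQuad h (velMap K γ h p).2) / ((1 + K * p.1 ^ 2) *
    √(1 + (densRoot K p.1 (hQuad h (velMap K γ h p).2) - 1) / (1 + K * p.1 ^ 2))) *
    (velMap K γ h p).2 a = p.2 a
  rw [(velMap_mem_and_densRoot hK hγ hpos hp).2, add_sub_cancel_left,
    mul_div_cancel_left₀ _ (by positivity : 1 + K * p.1 ^ 2 ≠ 0)]
  have : 0 < √(1 + hQuad h p.2) := Real.sqrt_pos.2 (by positivity)
  simp only [velMap, PhiMap]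
  field_simp

theorem hQuad_velInv (hK : 0 < K) (hγ : 1 < γ) (hpos : h.PosDef) {p : ℝ × (Fin 3 → ℝ)}
    (hp : p ∈ causalSet K γ h) :
    hQuad h (velInv K h p).2 = (densRoot K p.1 (hQuad h p.2) - 1) / (1 + K * p.1 ^ 2) := by
  have hw := mul_sq_lt_one_of_causal hK hγ hp.1
  have hb : 0 ≤ K * p.1 ^ 2 := by positivity
  have hD1 := one_le_densRoot hK.le hw (hQuad_nonneg hpos p.2) hp.2
  have he := densRoot_eq hK.le hw hp.2
  simp only [velInv, hQuad_smul]
  set D := densRoot K p.1 (hQuad h p.2)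
  have hq : 0 ≤ (D - 1) / (1 + K * p.1 ^ 2) := div_nonneg (by linarith) (by positivity)
  have hDb : D + K * p.1 ^ 2 ≠ 0 := by positivity
  have e : 1 + (D - 1) / (1 + K * p.1 ^ 2) = (D + K * p.1 ^ 2) / (1 + K * p.1 ^ 2) := by
    field_simp; ring
  rw [div_pow, mul_pow, Real.sq_sqrt (by positivity), e]
  field_simp
  linear_combination -he

theorem velMap_velInv (hK : 0 < K) (hγ : 1 < γ) (hpos : h.PosDef) {p : ℝ × (Fin 3 → ℝ)}
    (hp : p ∈ causalSet K γ h) : velMap K γ h (velInv K h p) = p := by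
  have hw := mul_sq_lt_one_of_causal hK hγ hp.1
  have hb : 0 ≤ K * p.1 ^ 2 := by positivity
  have hD1 := one_le_densRoot hK.le hw (hQuad_nonneg hpos p.2) hp.2
  refine Prod.ext rfl (funext fun a => ?_)
  change (1 + K * p.1 ^ 2) * (velInv K h p).2 a * √(1 + hQuad h (velInv K h p).2) /
    (1 + (1 + K * p.1 ^ 2) * hQuad h (velInv K h p).2) = p.2 a
  rw [hQuad_velInv hK hγ hpos hp]
  simp only [velInv]
  set D := densRoot K p.1 (hQuad h p.2)
  have hq : 0 ≤ (D - 1) / (1 + K * p.1 ^ 2) := div_nonneg (by linarith) (by positivity)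
  have : 0 < √(1 + (D - 1) / (1 + K * p.1 ^ 2)) := Real.sqrt_pos.2 (by positivity)
  rw [mul_div_cancel₀ _ (by positivity : 1 + K * p.1 ^ 2 ≠ 0), add_sub_cancel]
  generalize √(1 + (D - 1) / (1 + K * p.1 ^ 2)) = R at this ⊢
  field_simp

theorem contDiffAt_velInv (hK : 0 < K) (hγ : 1 < γ) (hpos : h.PosDef) {p : ℝ × (Fin 3 → ℝ)}
    (hp : p ∈ causalSet K γ h) {n : WithTop ℕ∞} : ContDiffAt ℝ n (velInv K h) p := by
  have hw := mul_sq_lt_one_of_causal hK hγ hp.1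
  have hD1 := one_le_densRoot hK.le hw (hQuad_nonneg hpos p.2) hp.2
  have hD := contDiffAt_densRoot_hQuad hK hγ hp (n := n)
  have ha : 0 < 1 + K * p.1 ^ 2 := by positivity
  have hq : 0 < 1 + (densRoot K p.1 (hQuad h p.2) - 1) / (1 + K * p.1 ^ 2) :=
    add_pos_of_pos_of_nonneg one_pos (div_nonneg (by linarith) ha.le)
  have hA : ContDiffAt ℝ n (fun p : ℝ × (Fin 3 → ℝ) => 1 + K * p.1 ^ 2) p := by fun_prop
  refine contDiffAt_fst.prodMk (contDiffAt_pi.2 fun a => ContDiffAt.mul ?_ (by fun_prop))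
  exact hD.div (hA.mul ((contDiffAt_const.add ((hD.sub contDiffAt_const).div hA ha.ne')).sqrt
    hq.ne')) (mul_pos ha (Real.sqrt_pos.2 hq)).ne'

theorem contDiff_PhiMap (hK : 0 < K) (hpos : h.PosDef) {n : WithTop ℕ∞} :
    ContDiff ℝ n (PhiMap K γ h) := by
  have hA : ContDiff ℝ n (fun p : ℝ × (Fin 3 → ℝ) => 1 + K * p.1 ^ 2) := by fun_prop
  have hQ : ContDiff ℝ n (fun p : ℝ × (Fin 3 → ℝ) => hQuad h p.2) :=
    (contDiff_hQuad h).comp contDiff_snd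
  have hD := contDiff_const (c := (1 : ℝ)).add (hA.mul hQ)
  have hq := fun p : ℝ × (Fin 3 → ℝ) => hQuad_nonneg hpos p.2
  have hD0 : ∀ p : ℝ × (Fin 3 → ℝ), 1 + (1 + K * p.1 ^ 2) * hQuad h p.2 ≠ 0 := fun p => by
    have := hq p
    positivity
  refine (contDiff_fst.mul (hD.rpow_const_of_ne hD0)).prodMk (contDiff_pi.2 fun a => ?_)
  refine ((hA.mul (by fun_prop)).mul ((contDiff_const.add hQ).sqrt fun p => ?_)).div hD hD0
  have := hq p
  positivity

theorem bijOn_PhiMap (hK : 0 < K) (hγ : 1 < γ) (hpos : h.PosDef) :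
    BijOn (PhiMap K γ h) {p | γ * K * p.1 ^ 2 < 1}
      {q | hQuad h q.2 < 1 ∧ |q.1| < densBound K γ √(hQuad h q.2)} := by
  have hvel : BijOn (velMap K γ h) {p | γ * K * p.1 ^ 2 < 1} (causalSet K γ h) :=
    InvOn.bijOn (f' := velInv K h)
      ⟨fun p hp => velInv_velMap hK hγ hpos hp, fun p hp => velMap_velInv hK hγ hpos hp⟩
      (fun p hp => (velMap_mem_and_densRoot hK hγ hpos hp).1) (fun p hp => hp.1)
  exact ((bijOn_densMap hK hγ hpos).comp hvel).congr
    fun p hp => densMap_velMap hK hγ hpos hp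

theorem exists_contDiffAt_leftInvOn_PhiMap (hK : 0 < K) (hγ : 1 < γ) (hpos : h.PosDef) :
    ∃ Ψ : ℝ × (Fin 3 → ℝ) → ℝ × (Fin 3 → ℝ),
      LeftInvOn Ψ (PhiMap K γ h) {p | γ * K * p.1 ^ 2 < 1} ∧
      ∀ p, γ * K * p.1 ^ 2 < 1 → ContDiffAt ℝ (⊤ : ℕ∞) Ψ (PhiMap K γ h p) := by
  have hinv : LeftInvOn (Function.invFunOn (densMap K γ h) (causalSet K γ h)) (densMap K γ h)
      (causalSet K γ h) := (bijOn_densMap hK hγ hpos).injOn.leftInvOn_invFunOn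
  refine ⟨velInv K h ∘ Function.invFunOn (densMap K γ h) (causalSet K γ h), ?_, ?_⟩
  · intro p hp
    rw [← densMap_velMap hK hγ hpos hp, Function.comp_apply,
      hinv (velMap_mem_and_densRoot hK hγ hpos hp).1, velInv_velMap hK hγ hpos hp]
  · intro p hp
    have hm := (velMap_mem_and_densRoot hK hγ hpos hp).1
    rw [← densMap_velMap hK hγ hpos hp]
    refine ContDiffAt.comp _ ?_ (contDiffAt_of_leftInvOn isOpen_causalSet (by simp) hinv hm
      (contDiffAt_densMap hK hγ hm) (injective_fderiv_densMap hK hγ hpos hm))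
    rw [hinv hm]
    exact contDiffAt_velInv hK hγ hpos hm

theorem exists_pos_fst_PhiMap_eq (hK : 0 < K) (hpos : h.PosDef) (p : ℝ × (Fin 3 → ℝ)) :
    ∃ t : ℝ, 0 < t ∧ (PhiMap K γ h p).1 = p.1 * t := by
  have := hQuad_nonneg hpos p.2
  exact ⟨_, Real.rpow_pos_of_pos (by positivity) _, rfl⟩

end

/-- Reconstruction theorem for the initial data.
There is `s : [0,1) → (0,∞)` such that `Φ` is a bijection from
`S = {(w,ū) : 0 ≤ w, γK w² < 1}` onto `Ω = {(y,v) : |v|²_h < 1, 0 ≤ y < s(|v|_h)}`,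
`Φ` and its inverse are continuous, and `Φ` restricts to a `C^∞` diffeomorphism between
the interiors `{0 < w, γKw² < 1}` and `{(y,v) ∈ Ω : 0 < y}`. -/
theorem reconstruction_initial_data (K γ : ℝ) (hK : 0 < K) (hγ : 1 < γ)
    (h : Matrix (Fin 3) (Fin 3) ℝ) (hsymm : h.IsSymm) (hpos : h.PosDef) :
    ∃ sfun : ℝ → ℝ, (∀ r ∈ Set.Ico (0 : ℝ) 1, 0 < sfun r) ∧
      ∃ Ψ : ℝ × (Fin 3 → ℝ) → ℝ × (Fin 3 → ℝ),
        -- the domain, the target and their "interiors"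
        (let S : Set (ℝ × (Fin 3 → ℝ)) := {p | 0 ≤ p.1 ∧ γ * K * p.1 ^ 2 < 1}
         let Ω : Set (ℝ × (Fin 3 → ℝ)) :=
           {q | hQuad h q.2 < 1 ∧ 0 ≤ q.1 ∧ q.1 < sfun (Real.sqrt (hQuad h q.2))}
         let S₀ : Set (ℝ × (Fin 3 → ℝ)) := {p | 0 < p.1 ∧ γ * K * p.1 ^ 2 < 1}
         let Ω₀ : Set (ℝ × (Fin 3 → ℝ)) := {q ∈ Ω | 0 < q.1}
         -- bijectivity and two-sided inverse
         Set.BijOn (PhiMap K γ h) S Ω ∧ Set.InvOn Ψ (PhiMap K γ h) S Ω ∧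
         -- continuity of the map and of its inverse
         ContinuousOn (PhiMap K γ h) S ∧ ContinuousOn Ψ Ω ∧
         -- C^∞ diffeomorphism between the interiors
         Set.BijOn (PhiMap K γ h) S₀ Ω₀ ∧
         ContDiffOn ℝ (⊤ : ℕ∞) (PhiMap K γ h) S₀ ∧
         ContDiffOn ℝ (⊤ : ℕ∞) Ψ Ω₀) := by
  obtain ⟨Ψ, hleft, hsmooth⟩ := exists_contDiffAt_leftInvOn_PhiMap hK hγ hpos
  have hbij := bijOn_PhiMap hK hγ hpos
  refine ⟨densBound K γ, fun r hr => densBound_pos hK hγ hr, Ψ, ?_⟩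
  intro S Ω S₀ Ω₀
  have hnonneg : ∀ p, 0 ≤ (PhiMap K γ h p).1 ↔ 0 ≤ p.1 := fun p => by
    obtain ⟨t, ht, e⟩ := exists_pos_fst_PhiMap_eq (γ := γ) hK hpos p
    rw [e, mul_nonneg_iff_of_pos_right ht]
  have hpos' : ∀ p, 0 < (PhiMap K γ h p).1 ↔ 0 < p.1 := fun p => by
    obtain ⟨t, ht, e⟩ := exists_pos_fst_PhiMap_eq (γ := γ) hK hpos p
    rw [e, mul_pos_iff_of_pos_right ht]
  have hS : BijOn (PhiMap K γ h) S Ω := by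
    refine ⟨fun p hp => ?_, hbij.injOn.mono fun p hp => hp.2, fun q hq => ?_⟩
    · have hq := hbij.mapsTo hp.2
      exact ⟨hq.1, (hnonneg p).2 hp.1, (le_abs_self _).trans_lt hq.2⟩
    · obtain ⟨p, hp, rfl⟩ := hbij.surjOn ⟨hq.1, (abs_of_nonneg hq.2.1).symm ▸ hq.2.2⟩
      exact ⟨p, ⟨(hnonneg p).1 hq.2.1, hp⟩, rfl⟩
  have hS₀ : BijOn (PhiMap K γ h) S₀ Ω₀ := by
    refine ⟨fun p hp => ⟨hS.mapsTo ⟨hp.1.le, hp.2⟩, (hpos' p).2 hp.1⟩,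
      hbij.injOn.mono fun p hp => hp.2, fun q hq => ?_⟩
    obtain ⟨p, hp, rfl⟩ := hS.surjOn hq.1
    exact ⟨p, ⟨(hpos' p).1 hq.2, hp.2⟩, rfl⟩
  have hΨ : ContDiffOn ℝ (⊤ : ℕ∞) Ψ Ω := fun q hq => by
    obtain ⟨p, hp, rfl⟩ := hS.surjOn hq
    exact (hsmooth p hp.2).contDiffWithinAt
  have hleftS : LeftInvOn Ψ (PhiMap K γ h) S := hleft.mono fun p hp => hp.2
  refine ⟨hS, ⟨hleftS, fun q hq => ?_⟩, (contDiff_PhiMap hK hpos (n := 0)).continuous.continuousOn,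
    hΨ.continuousOn, hS₀, (contDiff_PhiMap hK hpos).contDiffOn, hΨ.mono fun q hq => hq.1⟩
  obtain ⟨p, hp, rfl⟩ := hS.surjOn hq
  rw [hleftS hp]
end
end

section
/- Let g be an invertible symmetric real 4×4 matrix (indices α,β = 0,…,3), let u ∈ ℝ⁴ satisfy g_{αβ}u^αu^β = −1, and set u_α = g_{αβ}u^β, g^{αβ} = (g⁻¹)^{αβ}, P^ν{}_α = δ^ν_α + u^ν u_α, and Γ_{αβ} = g_{αβ} + 2u_α u_β. For σ, κ ∈ ℝ and ξ ∈ ℝ⁴ let M(ξ) be the 5×5 matrix with entries M₀₀ = κ²(u^νξ_ν), M_{0,1+β} = M_{1+α,0} = σκ P^ν{}_βξ_ν (resp. σκ P^ν{}_αξ_ν), and M_{1+α,1+β} = (u^νξ_ν)Γ_{αβ}. Then det M(ξ) = −κ² det(g) (u^νξ_ν)³ [ (u^νξ_ν)² − σ² P^ν{}_β ξ_ν ξ^β ], where ξ^β = g^{βα}ξ_α. Consequently the characteristic covectors of the relativistic Euler system split into the hyperplane {ξ : u^νξ_ν = 0} and the sound cone {ξ : (u^νξ_ν)² = σ² P^ν{}_βξ_νξ^β}.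 -/
open Matrix

noncomputable section

variable (g : Matrix (Fin 4) (Fin 4) ℝ) (u ξ : Fin 4 → ℝ) (σ κ : ℝ)

/-- The lowered velocity `u_α = g_{αβ} u^β`. -/
def ulow (g : Matrix (Fin 4) (Fin 4) ℝ) (u : Fin 4 → ℝ) (α : Fin 4) : ℝ :=
  ∑ β, g α β * u β

/-- The projection `P^ν{}_α = δ^ν_α + u^ν u_α` onto the rest space. -/
def projP (g : Matrix (Fin 4) (Fin 4) ℝ) (u : Fin 4 → ℝ) (ν α : Fin 4) : ℝ :=
  (if ν = α then 1 else 0) + u ν * ulow g u α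

/-- The reflection `Γ_{αβ} = g_{αβ} + 2 u_α u_β` with respect to the rest space. -/
def gammaRefl (g : Matrix (Fin 4) (Fin 4) ℝ) (u : Fin 4 → ℝ) (α β : Fin 4) : ℝ :=
  g α β + 2 * ulow g u α * ulow g u β

/-- The principal symbol `M(ξ) = ξ_ν A^ν` of the symmetric-hyperbolic formulation of the
relativistic Euler equations (one Makino-variable row/column and four velocity
rows/columns). -/
def symbolM (g : Matrix (Fin 4) (Fin 4) ℝ) (u ξ : Fin 4 → ℝ) (σ κ : ℝ) :
    Matrix (Unit ⊕ Fin 4) (Unit ⊕ Fin 4) ℝ :=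
  fun i j =>
    match i, j with
    | .inl _, .inl _ => κ ^ 2 * ∑ ν, u ν * ξ ν
    | .inl _, .inr β => σ * κ * ∑ ν, projP g u ν β * ξ ν
    | .inr α, .inl _ => σ * κ * ∑ ν, projP g u ν α * ξ ν
    | .inr α, .inr β => (∑ ν, u ν * ξ ν) * gammaRefl g u α β

/-- The determinant of a bordered matrix whose large block `s • D` has `E = D⁻¹`. -/
lemma det_bordered_smul {n : Type*} [Fintype n] [DecidableEq n] {s : ℝ} (hs : s ≠ 0) (a : ℝ)
    (b c : n → ℝ) {D E : Matrix n n ℝ} (hDE : D * E = 1) :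
    (fromBlocks (of fun _ _ : Unit => a) (replicateRow Unit b) (replicateCol Unit c) (s • D)).det =
      s ^ Fintype.card n * D.det * (a - s⁻¹ * (b ⬝ᵥ E *ᵥ c)) := by
  have hinv : (s • D) * (s⁻¹ • E) = 1 := by
    rw [smul_mul_smul_comm, mul_inv_cancel₀ hs, hDE, one_smul]
  let : Invertible (s • D) := invertibleOfRightInverse _ _ hinv
  rw [det_fromBlocks₂₂, det_smul, invOf_eq_right_inv hinv, det_unique (n := Unit), Matrix.mul_assoc,
    Matrix.smul_mul, Matrix.mul_smul, ← replicateCol_mulVec]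
  simp [Matrix.mul_apply, dotProduct]

/-- A bordered matrix whose large block vanishes is singular. -/
lemma det_bordered_zero {n : Type*} [Fintype n] [DecidableEq n] [Nontrivial n] (a : ℝ)
    (b c : n → ℝ) :
    (fromBlocks (of fun _ _ : Unit => a) (replicateRow Unit b) (replicateCol Unit c) 0).det = 0 := by
  obtain ⟨i, j, hij⟩ := exists_pair_ne n
  by_cases hb : b i = 0
  · refine det_eq_zero_of_column_eq_zero (Sum.inr i) ?_
    rintro (_ | _) <;> simp [hb]
  · refine exists_mulVec_eq_zero_iff.mp ⟨Sum.elim 0 (Pi.single i (b j) - Pi.single j (b i)), ?_, ?_⟩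
    · intro h
      have := congrFun h (Sum.inr j)
      simp [hij.symm, hb] at this
    · rw [fromBlocks_mulVec]
      ext (_ | _) <;> simp [mulVec_sub, mul_comm]

lemma ulow_eq_mulVec (g : Matrix (Fin 4) (Fin 4) ℝ) (u : Fin 4 → ℝ) : ulow g u = g *ᵥ u := rfl

lemma gammaRefl_eq (g : Matrix (Fin 4) (Fin 4) ℝ) (u : Fin 4 → ℝ) :
    of (gammaRefl g u) = g + (2 : ℝ) • vecMulVec (g *ᵥ u) (g *ᵥ u) := by
  ext α β
  simp [gammaRefl, ulow_eq_mulVec, vecMulVec_apply, mul_assoc]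

lemma det_gammaRefl {g : Matrix (Fin 4) (Fin 4) ℝ} {u : Fin 4 → ℝ} (hu : u ⬝ᵥ g *ᵥ u = -1) :
    (of (gammaRefl g u)).det = -g.det := by
  have h : of (gammaRefl g u) = g * (1 + vecMulVec u ((2 : ℝ) • (g *ᵥ u))) := by
    rw [gammaRefl_eq, Matrix.mul_add, mul_vecMulVec, vecMulVec_smul, Matrix.mul_one]
  rw [h, det_mul, vecMulVec_eq Unit, det_one_add_replicateCol_mul_replicateRow, smul_dotProduct,
    dotProduct_comm, hu]
  norm_num

lemma gammaRefl_mul_inv {g : Matrix (Fin 4) (Fin 4) ℝ} (hg : IsUnit g.det) (hsymm : g.IsSymm)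
    {u : Fin 4 → ℝ} (hu : u ⬝ᵥ g *ᵥ u = -1) :
    of (gammaRefl g u) * (g⁻¹ + (2 : ℝ) • vecMulVec u u) = 1 := by
  have h : (g *ᵥ u) ᵥ* g⁻¹ = u := by
    rw [← vecMul_transpose, hsymm.eq, vecMul_vecMul, mul_nonsing_inv _ hg, vecMul_one]
  rw [gammaRefl_eq, Matrix.add_mul, Matrix.mul_add, Matrix.mul_add, mul_nonsing_inv _ hg,
    Matrix.smul_mul, Matrix.smul_mul, Matrix.mul_smul, Matrix.mul_smul, vecMulVec_mul, h,
    mul_vecMulVec, vecMulVec_mul_vecMulVec, dotProduct_comm, hu]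
  ext i j
  simp [vecMulVec_apply]
  ring

lemma sum_projP_mul (g : Matrix (Fin 4) (Fin 4) ℝ) (u ξ : Fin 4 → ℝ) (β : Fin 4) :
    ∑ ν, projP g u ν β * ξ ν = (ξ + (u ⬝ᵥ ξ) • (g *ᵥ u)) β := by
  simp only [projP, add_mul, Finset.sum_add_distrib, ite_mul, one_mul, zero_mul,
    Finset.sum_ite_eq', Finset.mem_univ, if_true, Pi.add_apply, Pi.smul_apply, smul_eq_mul,
    dotProduct, Finset.sum_mul, ulow_eq_mulVec]
  exact congrArg _ (Finset.sum_congr rfl fun _ _ => by ring)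

lemma symbolM_eq_fromBlocks (g : Matrix (Fin 4) (Fin 4) ℝ) (u ξ : Fin 4 → ℝ) (σ κ : ℝ) :
    symbolM g u ξ σ κ =
      fromBlocks (of fun _ _ => κ ^ 2 * (u ⬝ᵥ ξ))
        (replicateRow Unit ((σ * κ) • (ξ + (u ⬝ᵥ ξ) • (g *ᵥ u))))
        (replicateCol Unit ((σ * κ) • (ξ + (u ⬝ᵥ ξ) • (g *ᵥ u))))
        ((u ⬝ᵥ ξ) • of (gammaRefl g u)) := by
  ext (_ | α) (_ | β)
  · rfl
  · exact congrArg _ (sum_projP_mul g u ξ β)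
  · exact congrArg _ (sum_projP_mul g u ξ α)
  · rfl

/-- The projected covector is orthogonal to `u`, so `Γ⁻¹` acts on it as `g⁻¹`. -/
lemma projected_dotProduct_inv {g : Matrix (Fin 4) (Fin 4) ℝ} (hg : IsUnit g.det)
    {u : Fin 4 → ℝ} (hu : u ⬝ᵥ g *ᵥ u = -1) (ξ : Fin 4 → ℝ) :
    (ξ + (u ⬝ᵥ ξ) • (g *ᵥ u)) ⬝ᵥ
        (g⁻¹ + (2 : ℝ) • vecMulVec u u) *ᵥ (ξ + (u ⬝ᵥ ξ) • (g *ᵥ u)) =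
      (ξ + (u ⬝ᵥ ξ) • (g *ᵥ u)) ⬝ᵥ g⁻¹ *ᵥ ξ := by
  have horth : u ⬝ᵥ (ξ + (u ⬝ᵥ ξ) • (g *ᵥ u)) = 0 := by
    rw [dotProduct_add, dotProduct_smul, hu]
    simp
  have hinv : g⁻¹ *ᵥ (ξ + (u ⬝ᵥ ξ) • (g *ᵥ u)) = g⁻¹ *ᵥ ξ + (u ⬝ᵥ ξ) • u := by
    rw [mulVec_add, mulVec_smul, mulVec_mulVec, nonsing_inv_mul _ hg, one_mulVec]
  have hrank : vecMulVec u u *ᵥ (ξ + (u ⬝ᵥ ξ) • (g *ᵥ u)) = 0 := by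
    rw [vecMulVec_mulVec, horth]
    simp
  rw [add_mulVec, smul_mulVec, hrank, smul_zero, add_zero, hinv, dotProduct_add, dotProduct_smul,
    dotProduct_comm _ u, horth, smul_zero, add_zero]

lemma sum_projP_mul_raised (g : Matrix (Fin 4) (Fin 4) ℝ) (u ξ : Fin 4 → ℝ) :
    ∑ ν, ∑ β, projP g u ν β * ξ ν * (∑ α, g⁻¹ β α * ξ α) =
      (ξ + (u ⬝ᵥ ξ) • (g *ᵥ u)) ⬝ᵥ g⁻¹ *ᵥ ξ := by
  rw [Finset.sum_comm]
  simp only [← Finset.sum_mul, sum_projP_mul]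
  rfl

lemma det_symbolM {g : Matrix (Fin 4) (Fin 4) ℝ} (hg : IsUnit g.det) (hsymm : g.IsSymm)
    {u : Fin 4 → ℝ} (hu : u ⬝ᵥ g *ᵥ u = -1) (ξ : Fin 4 → ℝ) (σ κ : ℝ) :
    (symbolM g u ξ σ κ).det =
      -(κ ^ 2) * g.det * (u ⬝ᵥ ξ) ^ 3 *
        ((u ⬝ᵥ ξ) ^ 2 - σ ^ 2 * ((ξ + (u ⬝ᵥ ξ) • (g *ᵥ u)) ⬝ᵥ g⁻¹ *ᵥ ξ)) := by
  rw [symbolM_eq_fromBlocks]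
  by_cases hs : u ⬝ᵥ ξ = 0
  · simp only [hs, zero_smul]
    rw [det_bordered_zero]
    ring
  · rw [det_bordered_smul hs _ _ _ (gammaRefl_mul_inv hg hsymm hu), det_gammaRefl hu, mulVec_smul,
      smul_dotProduct, dotProduct_smul, projected_dotProduct_inv hg hu]
    simp only [smul_eq_mul, Fintype.card_fin]
    field_simp

/-- Determinant of the principal symbol; characteristics of the
relativistic Euler system.
If `g` is an invertible symmetric 4×4 matrix, `u` is a unit timelike vector
(`g_{αβ}u^αu^β = −1`), then with `ξ^β = g^{βα}ξ_α`,
`det M(ξ) = −κ² det g · (u^νξ_ν)³ [ (u^νξ_ν)² − σ² P^ν{}_β ξ_ν ξ^β ]`;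
consequently (for `κ ≠ 0`) the characteristic covectors are exactly the union of the
hyperplane `u^νξ_ν = 0` and the sound cone `(u^νξ_ν)² = σ² P^ν{}_βξ_νξ^β`. -/
theorem euler_symbol_det (g : Matrix (Fin 4) (Fin 4) ℝ) (hg : IsUnit g.det)
    (hsymm : g.IsSymm) (u : Fin 4 → ℝ) (hu : ∑ α, ∑ β, g α β * u α * u β = -1)
    (σ κ : ℝ) (ξ : Fin 4 → ℝ) :
    (symbolM g u ξ σ κ).det =
      -(κ ^ 2) * g.det * (∑ ν, u ν * ξ ν) ^ 3 *
        ((∑ ν, u ν * ξ ν) ^ 2 -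
          σ ^ 2 * ∑ ν, ∑ β, projP g u ν β * ξ ν * (∑ α, g⁻¹ β α * ξ α)) ∧
    (κ ≠ 0 →
      ((symbolM g u ξ σ κ).det = 0 ↔
        (∑ ν, u ν * ξ ν) = 0 ∨
        (∑ ν, u ν * ξ ν) ^ 2 =
          σ ^ 2 * ∑ ν, ∑ β, projP g u ν β * ξ ν * (∑ α, g⁻¹ β α * ξ α))) := by
  have hu' : u ⬝ᵥ g *ᵥ u = -1 := by
    rw [← hu]
    simp only [dotProduct, mulVec, Finset.mul_sum]
    exact Finset.sum_congr rfl fun _ _ => Finset.sum_congr rfl fun _ _ => by ring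
  have hdet := det_symbolM hg hsymm hu' ξ σ κ
  rw [← sum_projP_mul_raised] at hdet
  refine ⟨hdet, fun hκ => ?_⟩
  rw [hdet]
  simp only [mul_eq_zero, neg_eq_zero, pow_eq_zero_iff, ne_eq, OfNat.ofNat_ne_zero,
    not_false_eq_true, hκ, hg.ne_zero, false_or, sub_eq_zero]
  rfl
end
end
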